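/- arXiv:2002.10814 — 5 statements merged into one kernel-verified Lean document; each statement's English description precedes it below -/
import Mathlib

section
/- For every process P, every sequence σ ∈ (A ∪ 𝒫(A))*, every refusal set X ⊆ A and every partial failure trace ρ: σXρ ∈ fft(P) if and only if σXXρ ∈ fft(P). -/
/-! ### The process algebra CCSP_t

The countably infinite set `A` of visible actions and the countably infinite set `V`
of variables are both taken to be `ℕ`. -/

/-- Actions: visible actions from `A = ℕ`, the hidden action `τ`,
and the time-out action `t`. -/
inductive Act : Type
  | act : ℕ → Act
  | tau : Act
  | timeout : Act

/-- CCSP_t expressions.  A recursive specification `S` is represented as a partial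
function `ℕ → Option Expr`; its domain is the set `V_S` of bound variables, and
`⟨X|S⟩` is written `Expr.fix X S`. -/
inductive Expr : Type
  | nil : Expr
  | pre : Act → Expr → Expr
  | choice : Expr → Expr → Expr
  | par : Set ℕ → Expr → Expr → Expr
  | abs : Set ℕ → Expr → Expr
  | ren : Set (ℕ × ℕ) → Expr → Expr
  | var : ℕ → Expr
  | fix : ℕ → (ℕ → Option Expr) → Expr

/-- `α.notIn S`: the action `α` is not a visible action belonging to `S ⊆ A`. -/
def Act.notIn (α : Act) (S : Set ℕ) : Prop := ∀ a : ℕ, α = Act.act a → a ∉ S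

/-- Relational substitution: `Subst ρ E E'` holds iff `E'` is the result of replacing,
in `E`, every free occurrence of each variable `Y` in the domain of `ρ` by the
expression `ρ Y` (occurrences bound by an inner recursion are not replaced). -/
inductive Subst : (ℕ → Option Expr) → Expr → Expr → Prop
  | nil {ρ} : Subst ρ .nil .nil
  | pre {ρ α E E'} : Subst ρ E E' → Subst ρ (.pre α E) (.pre α E')
  | choice {ρ E F E' F'} : Subst ρ E E' → Subst ρ F F' →
      Subst ρ (.choice E F) (.choice E' F')
  | par {ρ S E F E' F'} : Subst ρ E E' → Subst ρ F F' →
      Subst ρ (.par S E F) (.par S E' F')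
  | abs {ρ I E E'} : Subst ρ E E' → Subst ρ (.abs I E) (.abs I E')
  | ren {ρ R E E'} : Subst ρ E E' → Subst ρ (.ren R E) (.ren R E')
  | varNone {ρ Y} : ρ Y = none → Subst ρ (.var Y) (.var Y)
  | varSome {ρ Y F} : ρ Y = some F → Subst ρ (.var Y) F
  | fix {ρ Z} {T T' : ℕ → Option Expr} :
      (∀ Y, T Y = none ↔ T' Y = none) →
      (∀ Y E E', T Y = some E → T' Y = some E' →
          Subst (fun W => if (T W).isSome then none else ρ W) E E') →
      Subst ρ (.fix Z T) (.fix Z T')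

/-- The substitution replacing each bound variable `Y` of `S` by `⟨Y|S⟩`. -/
def recmap (S : ℕ → Option Expr) : ℕ → Option Expr :=
  fun Y => (S Y).map (fun _ => Expr.fix Y S)

/-- The structural operational (interleaving) semantics of CCSP_t. -/
inductive Step : Expr → Act → Expr → Prop
  | pre {α E} : Step (.pre α E) α E
  | choiceL {E F α E'} : Step E α E' → Step (.choice E F) α E'
  | choiceR {E F α F'} : Step F α F' → Step (.choice E F) α F'
  | renTau {R E E'} : Step E .tau E' → Step (.ren R E) .tau (.ren R E')
  | renTimeout {R E E'} : Step E .timeout E' →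
      Step (.ren R E) .timeout (.ren R E')
  | renAct {R E E' a b} : Step E (.act a) E' → (a, b) ∈ R →
      Step (.ren R E) (.act b) (.ren R E')
  | parL {S E F α E'} : Step E α E' → α.notIn S →
      Step (.par S E F) α (.par S E' F)
  | parR {S E F α F'} : Step F α F' → α.notIn S →
      Step (.par S E F) α (.par S E F')
  | parSync {S E F a E' F'} : Step E (.act a) E' → Step F (.act a) F' → a ∈ S →
      Step (.par S E F) (.act a) (.par S E' F')
  | absFree {I E α E'} : Step E α E' → α.notIn I →
      Step (.abs I E) α (.abs I E')
  | absHide {I E a E'} : Step E (.act a) E' → a ∈ I →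
      Step (.abs I E) .tau (.abs I E')
  | fixUnfold {X S E E' α F} : S X = some E → Subst (recmap S) E E' →
      Step E' α F → Step (.fix X S) α F

/-- Free occurrence of a variable in a CCSP_t expression. -/
inductive Free (x : ℕ) : Expr → Prop
  | pre {α E} : Free x E → Free x (.pre α E)
  | choiceL {E F} : Free x E → Free x (.choice E F)
  | choiceR {E F} : Free x F → Free x (.choice E F)
  | parL {S E F} : Free x E → Free x (.par S E F)
  | parR {S E F} : Free x F → Free x (.par S E F)
  | abs {I E} : Free x E → Free x (.abs I E)
  | ren {R E} : Free x E → Free x (.ren R E)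
  | var : Free x (.var x)
  | fix {Z T Y E} : T Y = some E → Free x E → T x = none → Free x (.fix Z T)

/-- An expression is closed if no variable occurs free in it. -/
def Closed (E : Expr) : Prop := ∀ x, ¬ Free x E

/-- Well-formedness: in every recursion `⟨X|S⟩` occurring in the expression the
variable `X` is bound by `S`, and every relational renaming occurring in it has
finite images `{b | (a,b) ∈ R}`. -/
inductive WF : Expr → Prop
  | nil : WF .nil
  | pre {α E} : WF E → WF (.pre α E)
  | choice {E F} : WF E → WF F → WF (.choice E F)
  | par {S E F} : WF E → WF F → WF (.par S E F)
  | abs {I E} : WF E → WF (.abs I E)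
  | ren {R E} : (∀ a : ℕ, {b | (a, b) ∈ R}.Finite) → WF E → WF (.ren R E)
  | var {X} : WF (.var X)
  | fix {X T} : (T X).isSome → (∀ Y E, T Y = some E → WF E) → WF (.fix X T)

/-- `ℙ`: a process is a closed well-formed CCSP_t expression. -/
def IsProcess (E : Expr) : Prop := Closed E ∧ WF E

/-- A process is stable if it has no outgoing τ-transitions. -/
def stable (P : Expr) : Prop := ¬ ∃ P', Step P .tau P'

/-- The set `I(P)` of initial visible actions of a process. -/
def initials (P : Expr) : Set ℕ := {a | ∃ P', Step P (.act a) P'}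

/-! ### Partial failure traces -/

/-- An element of a partial failure trace: a visible action `a ∈ A`
or a refusal set `X ⊆ A`. -/
abbrev Elt : Type := Sum ℕ (Set ℕ)

/-- Partial failure traces: sequences over `A ∪ 𝒫(A)`; the final tag `⊤` is
left implicit. -/
abbrev PFT : Type := List Elt

/-- The set of partial failure traces of a process (Table 3). -/
inductive fft : Expr → PFT → Prop
  | top {P} : fft P []
  | act {P Q a ρ} : Step P (.act a) Q → fft Q ρ → fft P (Sum.inl a :: ρ)
  | tau {P Q ρ} : Step P .tau Q → fft Q ρ → fft P ρ
  | refusal {P X ρ} : (∀ a ∈ X, a ∉ initials P) → stable P → fft P ρ →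
      fft P (Sum.inr X :: ρ)
  | timeoutRef {P Q X ρ} : (∀ a ∈ X, a ∉ initials P) → stable P →
      Step P .timeout Q → fft Q (Sum.inr X :: ρ) → fft P (Sum.inr X :: ρ)
  | timeoutAct {P Q X a ρ} : (∀ a' ∈ X, a' ∉ initials P) → stable P →
      Step P .timeout Q → fft Q (Sum.inl a :: ρ) → a ∈ X →
      fft P (Sum.inr X :: Sum.inl a :: ρ)

def fftSet (P : Expr) : Set PFT := {σ | fft P σ}

theorem fft_refusal_duplicate {P : Expr} {X : Set ℕ} {ρ : PFT}
    (h : fft P (Sum.inr X :: ρ)) : fft P (Sum.inr X :: Sum.inr X :: ρ) := by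
  generalize hs : (Sum.inr X :: ρ : PFT) = s at h ⊢
  induction h with
  | top => simp at hs
  | act => simp at hs
  | tau hstep _ ih => exact .tau hstep (ih hs)
  | refusal href hst h =>
    cases hs
    exact .refusal href hst (.refusal href hst h)
  | timeoutRef href hst hstep h =>
    cases hs
    exact .refusal href hst (.timeoutRef href hst hstep h)
  | timeoutAct href hst hstep h ha =>
    cases hs
    exact .refusal href hst (.timeoutAct href hst hstep h ha)

theorem fft_refusal_contract {P : Expr} {X : Set ℕ} {ρ : PFT}
    (h : fft P (Sum.inr X :: Sum.inr X :: ρ)) : fft P (Sum.inr X :: ρ) := by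
  generalize hs : (Sum.inr X :: Sum.inr X :: ρ : PFT) = s at h
  induction h with
  | top => simp at hs
  | act => simp at hs
  | tau hstep _ ih => exact .tau hstep (ih hs)
  | refusal _ _ h =>
    cases hs
    exact h
  | timeoutRef href hst hstep _ ih =>
    cases hs
    exact .timeoutRef href hst hstep (ih rfl)
  | timeoutAct => simp at hs

theorem fft_cons_mono {e : Elt} {ρ ρ' : PFT} (hhead : ρ.head? = ρ'.head?)
    (hmono : ∀ P, fft P ρ → fft P ρ') {P : Expr} (h : fft P (e :: ρ)) :
    fft P (e :: ρ') := by
  generalize hs : e :: ρ = s at h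
  induction h with
  | top => simp at hs
  | act hstep h =>
    cases hs
    exact .act hstep (hmono _ h)
  | tau hstep _ ih => exact .tau hstep (ih hs)
  | refusal href hst h =>
    cases hs
    exact .refusal href hst (hmono _ h)
  | timeoutRef href hst hstep _ ih =>
    cases hs
    exact .timeoutRef href hst hstep (ih rfl)
  | timeoutAct href hst hstep h ha =>
    cases hs
    obtain ⟨_, rfl⟩ := List.head?_eq_some_iff.mp hhead.symm
    exact .timeoutAct href hst hstep (hmono _ h) ha

theorem fft_append_mono (σ : PFT) {ρ ρ' : PFT} (hhead : ρ.head? = ρ'.head?)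
    (hmono : ∀ P, fft P ρ → fft P ρ') (P : Expr) (h : fft P (σ ++ ρ)) :
    fft P (σ ++ ρ') := by
  induction σ generalizing P with
  | nil => exact hmono P h
  | cons e σ ih => exact fft_cons_mono (by simp [List.head?_append, hhead]) ih h

/-- For every process `P`, every sequence `σ ∈ (A ∪ 𝒫(A))*`,
every refusal set `X ⊆ A` and every partial failure trace `ρ`:
`σXρ ∈ fft(P)` if and only if `σXXρ ∈ fft(P)`. -/
theorem fft_doubling (P : Expr) (hP : IsProcess P) (σ : List Elt) (X : Set ℕ)
    (ρ : List Elt) :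
    fft P (σ ++ Sum.inr X :: ρ) ↔ fft P (σ ++ Sum.inr X :: Sum.inr X :: ρ) :=
  ⟨fft_append_mono σ (by rfl) (fun _ => fft_refusal_duplicate) P,
    fft_append_mono σ (by rfl) (fun _ => fft_refusal_contract) P⟩
end

section
/- For all processes P and Q and every S ⊆ A: fft(P ∥_S Q) = col(fft(P) ∥_S fft(Q)). -/
/-! ### Decomposition of partial failure traces w.r.t. a synchronisation set -/

/-- Pointwise decomposition of an element of a partial failure trace into left and
right components (`none` plays the role of the placeholder `⋆`): actions in `S`
go to both sides, actions outside `S` to exactly one side, and refusal sets are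
split into a pair of refusal sets. -/
def EltDecomp (S : Set ℕ) : Elt → Option Elt → Option Elt → Prop
  | Sum.inl a, l, r =>
      (a ∈ S ∧ l = some (Sum.inl a) ∧ r = some (Sum.inl a)) ∨
      (a ∉ S ∧ ((l = some (Sum.inl a) ∧ r = none) ∨ (l = none ∧ r = some (Sum.inl a))))
  | Sum.inr _, l, r =>
      (∃ XL : Set ℕ, l = some (Sum.inr XL)) ∧ (∃ XR : Set ℕ, r = some (Sum.inr XR))

/-- `Decomp S σ L R`: the annotated sequences `L` (= σ^L) and `R` (= σ^R) form a
decomposition of `σ` w.r.t. `S`. -/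
inductive Decomp (S : Set ℕ) : PFT → List (Option Elt) → List (Option Elt) → Prop
  | nil : Decomp S [] [] []
  | cons {e l r σ L R} : EltDecomp S e l r → Decomp S σ L R →
      Decomp S (e :: σ) (l :: L) (r :: R)

/-- The occurrence of a refusal set at position `i` of `σ` is system-ended:
it is immediately followed in `σ` by an action belonging to it. -/
def SysEnded (σ : PFT) (i : ℕ) : Prop :=
  ∃ X a, σ[i]? = some (Sum.inr X) ∧ σ[i + 1]? = some (Sum.inl a) ∧ a ∈ X

/-- The occurrence of a refusal set at position `i` of the annotated sequence `L`
is system-ended in the trace obtained from `L` by deleting all `⋆`s: the next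
non-`⋆` element after position `i` is an action belonging to it. -/
def SysEndedAnn (L : List (Option Elt)) (i : ℕ) : Prop :=
  ∃ X a, L[i]? = some (some (Sum.inr X)) ∧
    ((L.drop (i + 1)).reduceOption).head? = some (Sum.inl a) ∧ a ∈ X

/-- A valid decomposition of `σ` w.r.t. `S`. -/
def ValidDecomp (S : Set ℕ) (σ : PFT) (L R : List (Option Elt)) : Prop :=
  Decomp S σ L R ∧
  ∀ i X, σ[i]? = some (Sum.inr X) →
    (SysEnded σ i ↔ (SysEndedAnn L i ∨ SysEndedAnn R i)) ∧
    ¬(SysEndedAnn L i ∧ SysEndedAnn R i) ∧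
    ∀ XL XR, L[i]? = some (some (Sum.inr XL)) → R[i]? = some (some (Sum.inr XR)) →
      XL \ S = X \ S ∧ XR \ S = X \ S ∧ (XL ∩ S) ∪ (XR ∩ S) = X ∩ S

/-- The composition `F ∥_S G` of two sets of partial failure traces. -/
def parTraces (S : Set ℕ) (F G : Set PFT) : Set PFT :=
  {σ | ∃ L R, ValidDecomp S σ L R ∧ L.reduceOption ∈ F ∧ R.reduceOption ∈ G}

/-- `col F`: the least superset of `F` such that `σXXρ ∈ col F` implies
`σXρ ∈ col F`. -/
inductive col (F : Set PFT) : PFT → Prop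
  | base {σ} : σ ∈ F → col F σ
  | dup {σ X ρ} : col F (σ ++ Sum.inr X :: Sum.inr X :: ρ) →
      col F (σ ++ Sum.inr X :: ρ)

def colSet (F : Set PFT) : Set PFT := {σ | col F σ}

/-! ### Transitions of a parallel composition -/

theorem mem_initials_par {S : Set ℕ} {P Q : Expr} {a : ℕ} :
    a ∈ initials (.par S P Q) ↔
      (a ∉ S ∧ (a ∈ initials P ∨ a ∈ initials Q)) ∨
      (a ∈ S ∧ a ∈ initials P ∧ a ∈ initials Q) := by
  constructor
  · rintro ⟨E, h⟩
    cases h with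
    | parL h hS => exact Or.inl ⟨hS a rfl, Or.inl ⟨_, h⟩⟩
    | parR h hS => exact Or.inl ⟨hS a rfl, Or.inr ⟨_, h⟩⟩
    | parSync h h' hS => exact Or.inr ⟨hS, ⟨_, h⟩, ⟨_, h'⟩⟩
  · rintro (⟨hS, ⟨_, h⟩ | ⟨_, h⟩⟩ | ⟨hS, ⟨_, h⟩, ⟨_, h'⟩⟩)
    · exact ⟨_, .parL h (by rintro b ⟨⟩; exact hS)⟩
    · exact ⟨_, .parR h (by rintro b ⟨⟩; exact hS)⟩
    · exact ⟨_, .parSync h h' hS⟩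

theorem tau_notIn (S : Set ℕ) : Act.tau.notIn S := by rintro a ⟨⟩

theorem timeout_notIn (S : Set ℕ) : Act.timeout.notIn S := by rintro a ⟨⟩

theorem act_notIn {S : Set ℕ} {a : ℕ} (h : a ∉ S) : (Act.act a).notIn S := by
  rintro b ⟨⟩; exact h

theorem stable_par {S : Set ℕ} {P Q : Expr} :
    stable (.par S P Q) ↔ stable P ∧ stable Q := by
  constructor
  · intro h
    exact ⟨fun ⟨_, h'⟩ => h ⟨_, .parL h' (tau_notIn S)⟩,
      fun ⟨_, h'⟩ => h ⟨_, .parR h' (tau_notIn S)⟩⟩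
  · rintro ⟨hP, hQ⟩ ⟨_, h⟩
    cases h with
    | parL h => exact hP ⟨_, h⟩
    | parR h => exact hQ ⟨_, h⟩

theorem initials_par_comm (S : Set ℕ) (P Q : Expr) :
    initials (.par S P Q) = initials (.par S Q P) := by
  ext a
  simp only [mem_initials_par]
  tauto

theorem stable_par_comm {S : Set ℕ} {P Q : Expr} (h : stable (.par S P Q)) :
    stable (.par S Q P) :=
  stable_par.2 (stable_par.1 h).symm

/-! ### Basic properties of partial failure traces -/

theorem fft.mem_initials {P : Expr} {a : ℕ} {ρ : PFT} (hP : stable P)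
    (h : fft P (Sum.inl a :: ρ)) : a ∈ initials P := by
  cases h with
  | act h => exact ⟨_, h⟩
  | tau h => exact absurd ⟨_, h⟩ hP

theorem fft.notMem_initials {P : Expr} {X : Set ℕ} {ρ : PFT} (hP : stable P)
    (h : fft P (Sum.inr X :: ρ)) : ∀ a ∈ X, a ∉ initials P := by
  cases h with
  | tau h => exact absurd ⟨_, h⟩ hP
  | refusal h => exact h
  | timeoutRef h => exact h
  | timeoutAct h => exact h

/-- A smaller refusal set may be inserted in front of a refusal set. -/
theorem fft.cons_subset {P : Expr} {X Y : Set ℕ} {ρ : PFT} (hYX : Y ⊆ X)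
    (h : fft P (Sum.inr X :: ρ)) : fft P (Sum.inr Y :: Sum.inr X :: ρ) := by
  generalize hσ : (Sum.inr X :: ρ : PFT) = σ at h
  induction h with
  | top => cases hσ
  | act => cases hσ
  | tau hs _ ih => exact .tau hs (ih hσ)
  | refusal hX hs h =>
    cases hσ
    exact .refusal (fun a ha => hX a (hYX ha)) hs (.refusal hX hs h)
  | timeoutRef hX hs ht _ ih =>
    cases hσ
    exact .timeoutRef (fun a ha => hX a (hYX ha)) hs ht (ih rfl)
  | timeoutAct hX hs ht h ha =>
    cases hσ
    exact .refusal (fun a ha => hX a (hYX ha)) hs (.timeoutAct hX hs ht h ha)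

/-- Adjacent equal refusal sets may be merged. -/
theorem fft.collapse {P : Expr} {X : Set ℕ} {σ ρ : PFT}
    (h : fft P (σ ++ Sum.inr X :: Sum.inr X :: ρ)) : fft P (σ ++ Sum.inr X :: ρ) := by
  generalize hτ : (σ ++ Sum.inr X :: Sum.inr X :: ρ : PFT) = τ at h
  induction h generalizing σ with
  | top => simp at hτ
  | act hs _ ih =>
    cases σ with
    | nil => cases hτ
    | cons e σ =>
      cases hτ
      exact .act hs (ih rfl)
  | tau hs _ ih => exact .tau hs (ih hτ)
  | refusal hX hs h ih =>
    cases σ with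
    | nil =>
      cases hτ
      exact h
    | cons e σ =>
      cases hτ
      exact .refusal hX hs (ih rfl)
  | timeoutRef hX hs ht _ ih =>
    cases σ with
    | nil =>
      cases hτ
      exact .timeoutRef hX hs ht (ih (σ := []) rfl)
    | cons e σ =>
      cases hτ
      exact .timeoutRef hX hs ht (ih (σ := _ :: σ) rfl)
  | timeoutAct hX hs ht _ ha ih =>
    match σ with
    | [] => cases hτ
    | [_] => cases hτ
    | _ :: b :: σ =>
      cases hτ
      exact .timeoutAct hX hs ht (ih (σ := _ :: σ) rfl) ha

/-! ### An inductive form of valid decompositions -/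

/-- The trace `σ` starts with an action belonging to `X`. -/
def EndsBy (X : Set ℕ) (σ : PFT) : Prop := ∃ a, σ.head? = some (Sum.inl a) ∧ a ∈ X

/-- `Merge S σ l r`: the traces `l` and `r` arise from a valid decomposition of `σ`. -/
inductive Merge (S : Set ℕ) : PFT → PFT → PFT → Prop
  | nil : Merge S [] [] []
  | sync {a σ l r} : a ∈ S → Merge S σ l r →
      Merge S (Sum.inl a :: σ) (Sum.inl a :: l) (Sum.inl a :: r)
  | left {a σ l r} : a ∉ S → Merge S σ l r →
      Merge S (Sum.inl a :: σ) (Sum.inl a :: l) r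
  | right {a σ l r} : a ∉ S → Merge S σ l r →
      Merge S (Sum.inl a :: σ) l (Sum.inl a :: r)
  | ref {X XL XR σ l r} : (EndsBy X σ ↔ (EndsBy XL l ∨ EndsBy XR r)) →
      ¬(EndsBy XL l ∧ EndsBy XR r) →
      XL \ S = X \ S → XR \ S = X \ S → (XL ∩ S) ∪ (XR ∩ S) = X ∩ S →
      Merge S σ l r → Merge S (Sum.inr X :: σ) (Sum.inr XL :: l) (Sum.inr XR :: r)

theorem Merge.symm {S : Set ℕ} {σ l r : PFT} (h : Merge S σ l r) : Merge S σ r l := by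
  induction h with
  | nil => exact .nil
  | sync hS _ ih => exact .sync hS ih
  | left hS _ ih => exact .right hS ih
  | right hS _ ih => exact .left hS ih
  | ref h1 h2 h3 h4 h5 _ ih =>
    exact .ref (h1.trans or_comm) (fun h => h2 h.symm) h4 h3 (by rw [Set.union_comm, h5]) ih

theorem sysEnded_succ (e : Elt) (σ : PFT) (i : ℕ) :
    SysEnded (e :: σ) (i + 1) ↔ SysEnded σ i := by
  simp [SysEnded]

theorem sysEndedAnn_succ (e : Option Elt) (L : List (Option Elt)) (i : ℕ) :
    SysEndedAnn (e :: L) (i + 1) ↔ SysEndedAnn L i := by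
  simp [SysEndedAnn]

theorem sysEnded_zero (X : Set ℕ) (σ : PFT) :
    SysEnded (Sum.inr X :: σ) 0 ↔ EndsBy X σ := by
  simp [SysEnded, EndsBy, List.head?_eq_getElem?]

theorem sysEndedAnn_zero (X : Set ℕ) (L : List (Option Elt)) :
    SysEndedAnn (some (Sum.inr X) :: L) 0 ↔ EndsBy X L.reduceOption := by
  simp [SysEndedAnn, EndsBy]

theorem validDecomp_act {S : Set ℕ} {a : ℕ} {σ : PFT} {l r : Option Elt}
    {L R : List (Option Elt)} :
    ValidDecomp S (Sum.inl a :: σ) (l :: L) (r :: R) ↔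
      EltDecomp S (Sum.inl a) l r ∧ ValidDecomp S σ L R := by
  constructor
  · rintro ⟨_ | ⟨he, hd⟩, hv⟩
    refine ⟨he, hd, fun i X hi => ?_⟩
    simpa [sysEnded_succ, sysEndedAnn_succ] using hv (i + 1) X (by simpa using hi)
  · rintro ⟨he, hd, hv⟩
    refine ⟨.cons he hd, fun i X hi => ?_⟩
    cases i with
    | zero => simp at hi
    | succ i =>
      simpa [sysEnded_succ, sysEndedAnn_succ] using hv i X (by simpa using hi)

theorem validDecomp_ref {S X XL XR : Set ℕ} {σ : PFT} {L R : List (Option Elt)} :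
    ValidDecomp S (Sum.inr X :: σ) (some (Sum.inr XL) :: L) (some (Sum.inr XR) :: R) ↔
      ((EndsBy X σ ↔ (EndsBy XL L.reduceOption ∨ EndsBy XR R.reduceOption)) ∧
        ¬(EndsBy XL L.reduceOption ∧ EndsBy XR R.reduceOption) ∧
        XL \ S = X \ S ∧ XR \ S = X \ S ∧ (XL ∩ S) ∪ (XR ∩ S) = X ∩ S) ∧
      ValidDecomp S σ L R := by
  constructor
  · rintro ⟨_ | ⟨he, hd⟩, hv⟩
    refine ⟨?_, hd, fun i Y hi => ?_⟩
    · obtain ⟨h1, h2, h3⟩ := hv 0 X rfl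
      simp only [sysEnded_zero, sysEndedAnn_zero] at h1 h2
      exact ⟨h1, h2, h3 XL XR rfl rfl⟩
    · simpa [sysEnded_succ, sysEndedAnn_succ] using hv (i + 1) Y (by simpa using hi)
  · rintro ⟨⟨h1, h2, h3⟩, hd, hv⟩
    refine ⟨.cons ⟨⟨XL, rfl⟩, ⟨XR, rfl⟩⟩ hd, fun i Y hi => ?_⟩
    cases i with
    | zero =>
      obtain rfl : X = Y := by simpa using hi
      simp only [sysEnded_zero, sysEndedAnn_zero]
      refine ⟨h1, h2, fun YL YR hL hR => ?_⟩
      obtain rfl : XL = YL := by simpa using hL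
      obtain rfl : XR = YR := by simpa using hR
      exact h3
    | succ i =>
      simpa [sysEnded_succ, sysEndedAnn_succ] using hv i Y (by simpa using hi)

theorem ValidDecomp.merge {S : Set ℕ} {σ : PFT} {L R : List (Option Elt)}
    (h : ValidDecomp S σ L R) : Merge S σ L.reduceOption R.reduceOption := by
  have hd := h.1
  induction hd with
  | nil => exact .nil
  | @cons e l r σ L R he hd ih =>
    cases e with
    | inl a =>
      have ih := ih (validDecomp_act.1 h).2
      rcases he with ⟨hS, rfl, rfl⟩ | ⟨hS, ⟨rfl, rfl⟩ | ⟨rfl, rfl⟩⟩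
      · exact .sync hS ih
      · exact .left hS ih
      · exact .right hS ih
    | inr X =>
      obtain ⟨⟨XL, rfl⟩, ⟨XR, rfl⟩⟩ := he
      obtain ⟨⟨h1, h2, h3, h4, h5⟩, hv⟩ := validDecomp_ref.1 h
      exact .ref h1 h2 h3 h4 h5 (ih hv)

theorem Merge.exists_validDecomp {S : Set ℕ} {σ l r : PFT} (h : Merge S σ l r) :
    ∃ L R, ValidDecomp S σ L R ∧ L.reduceOption = l ∧ R.reduceOption = r := by
  induction h with
  | nil => exact ⟨[], [], ⟨.nil, by simp⟩, rfl, rfl⟩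
  | @sync a _ _ _ hS _ ih =>
    obtain ⟨L, R, hv, rfl, rfl⟩ := ih
    exact ⟨some (Sum.inl a) :: L, some (Sum.inl a) :: R,
      validDecomp_act.2 ⟨Or.inl ⟨hS, rfl, rfl⟩, hv⟩, rfl, rfl⟩
  | @left a _ _ _ hS _ ih =>
    obtain ⟨L, R, hv, rfl, rfl⟩ := ih
    exact ⟨some (Sum.inl a) :: L, none :: R,
      validDecomp_act.2 ⟨Or.inr ⟨hS, Or.inl ⟨rfl, rfl⟩⟩, hv⟩, rfl, rfl⟩
  | @right a _ _ _ hS _ ih =>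
    obtain ⟨L, R, hv, rfl, rfl⟩ := ih
    exact ⟨none :: L, some (Sum.inl a) :: R,
      validDecomp_act.2 ⟨Or.inr ⟨hS, Or.inr ⟨rfl, rfl⟩⟩, hv⟩, rfl, rfl⟩
  | @ref X XL XR _ _ _ h1 h2 h3 h4 h5 _ ih =>
    obtain ⟨L, R, hv, rfl, rfl⟩ := ih
    exact ⟨some (Sum.inr XL) :: L, some (Sum.inr XR) :: R,
      validDecomp_ref.2 ⟨⟨h1, h2, h3, h4, h5⟩, hv⟩, rfl, rfl⟩

theorem mem_parTraces {S : Set ℕ} {F G : Set PFT} {σ : PFT} :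
    σ ∈ parTraces S F G ↔ ∃ l r, Merge S σ l r ∧ l ∈ F ∧ r ∈ G := by
  constructor
  · rintro ⟨L, R, hv, hL, hR⟩
    exact ⟨_, _, hv.merge, hL, hR⟩
  · rintro ⟨l, r, hm, hl, hr⟩
    obtain ⟨L, R, hv, rfl, rfl⟩ := hm.exists_validDecomp
    exact ⟨L, R, hv, hl, hr⟩

/-! ### Merging traces of the components -/

/-- Partial failure traces annotated with the size of their derivation. -/
inductive SizedFft : ℕ → Expr → PFT → Prop
  | top {P} : SizedFft 0 P []
  | act {n P Q a ρ} : Step P (.act a) Q → SizedFft n Q ρ →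
      SizedFft (n + 1) P (Sum.inl a :: ρ)
  | tau {n P Q ρ} : Step P .tau Q → SizedFft n Q ρ → SizedFft (n + 1) P ρ
  | refusal {n P X ρ} : (∀ a ∈ X, a ∉ initials P) → stable P → SizedFft n P ρ →
      SizedFft (n + 1) P (Sum.inr X :: ρ)
  | timeoutRef {n P Q X ρ} : (∀ a ∈ X, a ∉ initials P) → stable P →
      Step P .timeout Q → SizedFft n Q (Sum.inr X :: ρ) →
      SizedFft (n + 1) P (Sum.inr X :: ρ)
  | timeoutAct {n P Q X a ρ} : (∀ a' ∈ X, a' ∉ initials P) → stable P →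
      Step P .timeout Q → SizedFft n Q (Sum.inl a :: ρ) → a ∈ X →
      SizedFft (n + 1) P (Sum.inr X :: Sum.inl a :: ρ)

theorem fft.exists_sized {P : Expr} {σ : PFT} (h : fft P σ) : ∃ n, SizedFft n P σ := by
  induction h with
  | top => exact ⟨_, .top⟩
  | act hs _ ih => exact ih.imp' _ fun _ h => .act hs h
  | tau hs _ ih => exact ih.imp' _ fun _ h => .tau hs h
  | refusal hX hs _ ih => exact ih.imp' _ fun _ h => .refusal hX hs h
  | timeoutRef hX hs ht _ ih => exact ih.imp' _ fun _ h => .timeoutRef hX hs ht h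
  | timeoutAct hX hs ht _ ha ih => exact ih.imp' _ fun _ h => .timeoutAct hX hs ht h ha

theorem refuses_par {S X XL XR : Set ℕ} {P Q : Expr}
    (hL : XL \ S = X \ S) (hR : XR \ S = X \ S) (hS : (XL ∩ S) ∪ (XR ∩ S) = X ∩ S)
    (hP : ∀ a ∈ XL, a ∉ initials P) (hQ : ∀ a ∈ XR, a ∉ initials Q) :
    ∀ a ∈ X, a ∉ initials (.par S P Q) := by
  intro a ha h
  have hL' := Set.ext_iff.1 hL a
  have hR' := Set.ext_iff.1 hR a
  have hS' := Set.ext_iff.1 hS a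
  have hP' := hP a
  have hQ' := hQ a
  simp only [Set.mem_sdiff, Set.mem_union, Set.mem_inter_iff] at hL' hR' hS'
  rw [mem_initials_par] at h
  tauto

theorem fft_par_timeoutAct {S X : Set ℕ} {P Q E : Expr} {σ : PFT}
    (hX : ∀ a ∈ X, a ∉ initials (.par S P Q)) (hs : stable (.par S P Q))
    (ht : Step (.par S P Q) .timeout E) (he : EndsBy X σ) (h : fft E σ) :
    fft (.par S P Q) (Sum.inr X :: σ) := by
  obtain ⟨a, ha, haX⟩ := he
  obtain ⟨ρ, rfl⟩ : ∃ ρ, σ = Sum.inl a :: ρ := by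
    cases σ with
    | nil => simp at ha
    | cons e ρ => exact ⟨ρ, by simpa using ha⟩
  exact .timeoutAct hX hs ht h haX

theorem fft_par_of_merge {S : Set ℕ} {n m k : ℕ} {P Q : Expr} {σ l r : PFT}
    (hn : m + k = n) (hl : SizedFft m P l) (hr : SizedFft k Q r) (h : Merge S σ l r) :
    fft (.par S P Q) σ := by
  induction n using Nat.strong_induction_on generalizing m k P Q σ l r with
  | _ n ih =>
  have tauL : ∀ {i P'}, Step P .tau P' → i < m → SizedFft i P' l → fft (.par S P Q) σ :=
    fun hs hi h' => .tau (.parL hs (tau_notIn S)) (ih _ (by omega) rfl h' hr h)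
  have tauR : ∀ {i Q'}, Step Q .tau Q' → i < k → SizedFft i Q' r → fft (.par S P Q) σ :=
    fun hs hi h' => .tau (.parR hs (tau_notIn S)) (ih _ (by omega) rfl hl h' h)
  cases h with
  | nil => exact .top
  | sync hS hm =>
    cases hl with
    | tau hs hl => exact tauL hs (by omega) hl
    | act hs hl =>
      cases hr with
      | tau hs' hr => exact tauR hs' (by omega) hr
      | act hs' hr => exact .act (.parSync hs hs' hS) (ih _ (by omega) rfl hl hr hm)
  | left hS hm =>
    cases hl with
    | tau hs hl => exact tauL hs (by omega) hl
    | act hs hl =>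
      exact .act (.parL hs (act_notIn hS)) (ih _ (by omega) rfl hl hr hm)
  | right hS hm =>
    cases hr with
    | tau hs hr => exact tauR hs (by omega) hr
    | act hs hr =>
      exact .act (.parR hs (act_notIn hS)) (ih _ (by omega) rfl hl hr hm)
  | ref h1 h2 h3 h4 h5 hm =>
    have h := Merge.ref h1 h2 h3 h4 h5 hm
    have hX := fun hP hQ => refuses_par (P := P) (Q := Q) h3 h4 h5 hP hQ
    have refL : ∀ {i P'}, Step P .timeout P' → stable P → stable Q →
        (∀ a ∈ _, a ∉ initials P) → (∀ a ∈ _, a ∉ initials Q) →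
        i < m → SizedFft i P' _ → fft (.par S P Q) _ :=
      fun ht hP hQ hXP hXQ hi h' =>
        .timeoutRef (hX hXP hXQ) (stable_par.2 ⟨hP, hQ⟩) (.parL ht (timeout_notIn S))
          (ih _ (by omega) rfl h' hr h)
    have refR : ∀ {i Q'}, Step Q .timeout Q' → stable P → stable Q →
        (∀ a ∈ _, a ∉ initials P) → (∀ a ∈ _, a ∉ initials Q) →
        i < k → SizedFft i Q' _ → fft (.par S P Q) _ :=
      fun ht hP hQ hXP hXQ hi h' =>
        .timeoutRef (hX hXP hXQ) (stable_par.2 ⟨hP, hQ⟩) (.parR ht (timeout_notIn S))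
          (ih _ (by omega) rfl hl h' h)
    cases hl with
    | tau hs hl => exact tauL hs (by omega) hl
    | refusal hXP hP hl =>
      cases hr with
      | tau hs hr => exact tauR hs (by omega) hr
      | refusal hXQ hQ hr =>
        exact .refusal (hX hXP hXQ) (stable_par.2 ⟨hP, hQ⟩) (ih _ (by omega) rfl hl hr hm)
      | timeoutRef hXQ hQ ht hr => exact refR ht hP hQ hXP hXQ (by omega) hr
      | timeoutAct hXQ hQ ht hr ha =>
        exact fft_par_timeoutAct (hX hXP hXQ) (stable_par.2 ⟨hP, hQ⟩)
          (.parR ht (timeout_notIn S)) (h1.2 (Or.inr ⟨_, rfl, ha⟩))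
          (ih _ (by omega) rfl hl hr hm)
    | timeoutRef hXP hP ht hl =>
      cases hr with
      | tau hs hr => exact tauR hs (by omega) hr
      | refusal hXQ hQ hr => exact refL ht hP hQ hXP hXQ (by omega) hl
      | timeoutRef hXQ hQ _ hr => exact refL ht hP hQ hXP hXQ (by omega) hl
      | timeoutAct hXQ hQ _ hr ha => exact refL ht hP hQ hXP hXQ (by omega) hl
    | timeoutAct hXP hP ht hl ha =>
      cases hr with
      | tau hs hr => exact tauR hs (by omega) hr
      | refusal hXQ hQ hr =>
        exact fft_par_timeoutAct (hX hXP hXQ) (stable_par.2 ⟨hP, hQ⟩)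
          (.parL ht (timeout_notIn S)) (h1.2 (Or.inl ⟨_, rfl, ha⟩))
          (ih _ (by omega) rfl hl hr hm)
      | timeoutRef hXQ hQ ht hr => exact refR ht hP hQ hXP hXQ (by omega) hr
      | timeoutAct _ _ _ _ hb => exact absurd ⟨⟨_, rfl, ha⟩, ⟨_, rfl, hb⟩⟩ h2

/-! ### Decomposing traces of a parallel composition -/

/-- `Expands σ' σ`: the trace `σ'` arises from `σ` by repeating refusal sets. -/
inductive Expands : PFT → PFT → Prop
  | nil : Expands [] []
  | cons {e σ' σ} : Expands σ' σ → Expands (e :: σ') (e :: σ)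
  | dup {X σ' σ} : Expands (Sum.inr X :: σ') (Sum.inr X :: σ) →
      Expands (Sum.inr X :: Sum.inr X :: σ') (Sum.inr X :: σ)

theorem Expands.exists_eq_cons {e : Elt} {σ' σ : PFT} (h : Expands σ' (e :: σ)) :
    ∃ ρ, σ' = e :: ρ := by
  cases h with
  | cons => exact ⟨_, rfl⟩
  | dup => exact ⟨_, rfl⟩

theorem Expands.col {F : Set PFT} {σ' σ : PFT} (h : Expands σ' σ) (π : PFT)
    (hc : col F (π ++ σ')) : col F (π ++ σ) := by
  induction h generalizing π with
  | nil => exact hc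
  | @cons e _ _ _ ih => simpa using ih (π ++ [e]) (by simpa using hc)
  | dup _ ih => exact ih π (.dup hc)

/-- `σ` has an expansion that merges a trace of `P` with a trace of `Q`. -/
def Splits (S : Set ℕ) (P Q : Expr) (σ : PFT) : Prop :=
  ∃ σ' l r, Expands σ' σ ∧ Merge S σ' l r ∧ fft P l ∧ fft Q r

theorem Splits.symm {S : Set ℕ} {P Q : Expr} {σ : PFT} (h : Splits S P Q σ) :
    Splits S Q P σ := by
  obtain ⟨σ', l, r, he, hm, hl, hr⟩ := h
  exact ⟨σ', r, l, he, hm.symm, hr, hl⟩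

theorem not_endsBy_diff_initials {P : Expr} {X : Set ℕ} {l : PFT} (hP : stable P)
    (hl : fft P l) : ¬ EndsBy (X \ initials P) l := by
  rintro ⟨a, ha, haX⟩
  cases l with
  | nil => simp at ha
  | cons e l =>
    obtain rfl : e = Sum.inl a := by simpa using ha
    exact haX.2 (hl.mem_initials hP)

theorem diff_initials_diff {S X : Set ℕ} {P Q : Expr}
    (hX : ∀ a ∈ X, a ∉ initials (.par S P Q)) :
    (X \ initials P) \ S = X \ S := by
  ext a
  have := hX a
  rw [mem_initials_par] at this
  simp only [Set.mem_sdiff]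
  tauto

theorem diff_initials_inter_union {S X : Set ℕ} {P Q : Expr}
    (hX : ∀ a ∈ X, a ∉ initials (.par S P Q)) :
    ((X \ initials P) ∩ S) ∪ ((X \ initials Q) ∩ S) = X ∩ S := by
  ext a
  have := hX a
  rw [mem_initials_par] at this
  simp only [Set.mem_union, Set.mem_inter_iff, Set.mem_sdiff]
  tauto

theorem Splits.refusal {S X : Set ℕ} {P Q : Expr} {ρ : PFT}
    (hX : ∀ a ∈ X, a ∉ initials (.par S P Q)) (hs : stable (.par S P Q))
    (h : Splits S P Q ρ) : Splits S P Q (Sum.inr X :: ρ) := by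
  obtain ⟨hP, hQ⟩ := stable_par.1 hs
  obtain ⟨σ, l, r, he, hm, hl, hr⟩ := h
  have hL := not_endsBy_diff_initials (X := X) hP hl
  have hR := not_endsBy_diff_initials (X := X) hQ hr
  have hσ : ¬ EndsBy X σ := by
    rintro ⟨a, ha, haX⟩
    apply hX a haX
    rw [mem_initials_par]
    cases hm with
    | nil => simp at ha
    | sync hS =>
      obtain rfl := Sum.inl.inj (Option.some.inj ha)
      exact Or.inr ⟨hS, hl.mem_initials hP, hr.mem_initials hQ⟩
    | left hS =>
      obtain rfl := Sum.inl.inj (Option.some.inj ha)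
      exact Or.inl ⟨hS, Or.inl (hl.mem_initials hP)⟩
    | right hS =>
      obtain rfl := Sum.inl.inj (Option.some.inj ha)
      exact Or.inl ⟨hS, Or.inr (hr.mem_initials hQ)⟩
    | ref => simp at ha
  refine ⟨_, _, _, .cons he, .ref (XL := X \ initials P) (XR := X \ initials Q)
    (by tauto) (by tauto) (diff_initials_diff hX)
    (diff_initials_diff (initials_par_comm S P Q ▸ hX))
    (diff_initials_inter_union hX) hm,
    .refusal (fun _ ha => ha.2) hP hl, .refusal (fun _ ha => ha.2) hQ hr⟩

theorem Splits.timeoutRef {S X : Set ℕ} {P P' Q : Expr} {ρ : PFT}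
    (hX : ∀ a ∈ X, a ∉ initials (.par S P Q)) (hs : stable (.par S P Q))
    (ht : Step P .timeout P') (h : Splits S P' Q (Sum.inr X :: ρ)) :
    Splits S P Q (Sum.inr X :: ρ) := by
  obtain ⟨hP, hQ⟩ := stable_par.1 hs
  obtain ⟨σ, l, r, he, hm, hl, hr⟩ := h
  obtain ⟨σ, rfl⟩ := he.exists_eq_cons
  cases hm with
  | @ref _ XL XR _ l r h1 h2 h3 h4 h5 hm =>
  have hXR := hr.notMem_initials hQ
  refine ⟨_, _, _, .dup he, .ref (XL := XL \ initials P) (XR := X \ initials Q)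
    (by simp [EndsBy]) (by simp [EndsBy]) ?_
    (diff_initials_diff (initials_par_comm S P Q ▸ hX)) ?_ (.ref h1 h2 h3 h4 h5 hm),
    .timeoutRef (fun _ ha => ha.2) hP ht (hl.cons_subset Set.sdiff_subset),
    .refusal (fun _ ha => ha.2) hQ hr⟩
  · rw [Set.sdiff_sdiff_comm, h3, Set.sdiff_sdiff_comm, diff_initials_diff hX]
  · ext a
    have h5' := Set.ext_iff.1 h5 a
    have hX' := hX a
    have hXR' := hXR a
    rw [mem_initials_par] at hX'
    simp only [Set.mem_union, Set.mem_inter_iff, Set.mem_sdiff] at h5' ⊢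
    clear h1 h2 h3 h4 h5 hX hXR
    grind

theorem Splits.timeoutAct {S X : Set ℕ} {P P' Q : Expr} {a : ℕ} {ρ : PFT}
    (hX : ∀ a ∈ X, a ∉ initials (.par S P Q)) (hs : stable (.par S P Q))
    (ht : Step P .timeout P') (h : Splits S P' Q (Sum.inl a :: ρ)) (ha : a ∈ X) :
    Splits S P Q (Sum.inr X :: Sum.inl a :: ρ) := by
  obtain ⟨hP, hQ⟩ := stable_par.1 hs
  obtain ⟨σ, l, r, he, hm, hl, hr⟩ := h
  obtain ⟨σ, rfl⟩ := he.exists_eq_cons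
  have hR := not_endsBy_diff_initials (X := X) hQ hr
  have hXa := hX a ha
  rw [mem_initials_par] at hXa
  obtain ⟨l, rfl, haP⟩ : ∃ l', l = Sum.inl a :: l' ∧ a ∉ initials P := by
    cases hm with
    | sync hS =>
      have := hr.mem_initials hQ
      exact ⟨_, rfl, by tauto⟩
    | left hS => exact ⟨_, rfl, by tauto⟩
    | right hS =>
      have := hr.mem_initials hQ
      tauto
  have hL : EndsBy (X \ initials P) (Sum.inl a :: l) := ⟨a, rfl, ha, haP⟩
  have hσ : EndsBy X (Sum.inl a :: σ) := ⟨a, rfl, ha⟩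
  exact ⟨_, _, _, .cons he, .ref (XL := X \ initials P) (XR := X \ initials Q)
    (by tauto) (by tauto) (diff_initials_diff hX)
    (diff_initials_diff (initials_par_comm S P Q ▸ hX))
    (diff_initials_inter_union hX) hm,
    .timeoutAct (fun _ ha => ha.2) hP ht hl ⟨ha, haP⟩,
    .refusal (fun _ ha => ha.2) hQ hr⟩

theorem fft.splits {S : Set ℕ} {P Q : Expr} {σ : PFT} (h : fft (.par S P Q) σ) :
    Splits S P Q σ := by
  generalize hE : Expr.par S P Q = E at h
  induction h generalizing P Q with
  | top => exact ⟨_, _, _, .nil, .nil, .top, .top⟩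
  | act hs _ ih =>
    subst hE
    cases hs with
    | parL hs hS =>
      obtain ⟨σ', l, r, he, hm, hl, hr⟩ := ih rfl
      exact ⟨_, _, _, .cons he, .left (hS _ rfl) hm, .act hs hl, hr⟩
    | parR hs hS =>
      obtain ⟨σ', l, r, he, hm, hl, hr⟩ := ih rfl
      exact ⟨_, _, _, .cons he, .right (hS _ rfl) hm, hl, .act hs hr⟩
    | parSync hs hs' hS =>
      obtain ⟨σ', l, r, he, hm, hl, hr⟩ := ih rfl
      exact ⟨_, _, _, .cons he, .sync hS hm, .act hs hl, .act hs' hr⟩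
  | tau hs _ ih =>
    subst hE
    cases hs with
    | parL hs =>
      obtain ⟨σ', l, r, he, hm, hl, hr⟩ := ih rfl
      exact ⟨_, _, _, he, hm, .tau hs hl, hr⟩
    | parR hs =>
      obtain ⟨σ', l, r, he, hm, hl, hr⟩ := ih rfl
      exact ⟨_, _, _, he, hm, hl, .tau hs hr⟩
  | refusal hX hs _ ih =>
    subst hE
    exact (ih rfl).refusal hX hs
  | timeoutRef hX hs ht _ ih =>
    subst hE
    cases ht with
    | parL ht => exact (ih rfl).timeoutRef hX hs ht
    | parR ht =>
      exact ((ih rfl).symm.timeoutRef (initials_par_comm S P Q ▸ hX)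
        (stable_par_comm hs) ht).symm
  | timeoutAct hX hs ht _ ha ih =>
    subst hE
    cases ht with
    | parL ht => exact (ih rfl).timeoutAct hX hs ht ha
    | parR ht =>
      exact ((ih rfl).symm.timeoutAct (initials_par_comm S P Q ▸ hX)
        (stable_par_comm hs) ht ha).symm

/-- For all processes `P` and `Q` and every `S ⊆ A`:
`fft(P ∥_S Q) = col(fft(P) ∥_S fft(Q))`. -/
theorem fft_par_explicit (S : Set ℕ) (P Q : Expr)
    (hP : IsProcess P) (hQ : IsProcess Q) :
    fftSet (.par S P Q) = colSet (parTraces S (fftSet P) (fftSet Q)) := by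
  ext σ
  constructor
  · intro h
    obtain ⟨σ', l, r, he, hm, hl, hr⟩ := fft.splits h
    exact he.col [] (.base (mem_parTraces.2 ⟨l, r, hm, hl, hr⟩))
  · intro h
    change col _ σ at h
    change fft _ σ
    induction h with
    | base h =>
      obtain ⟨l, r, hm, hl, hr⟩ := mem_parTraces.1 h
      obtain ⟨m, hl⟩ := fft.exists_sized hl
      obtain ⟨k, hr⟩ := fft.exists_sized hr
      exact fft_par_of_merge rfl hl hr hm
    | dup _ ih => exact ih.collapse
end

section
/- For every process P, every I ⊆ A and every partial failure trace σ: σ ∈ fft(τ_I(P)) if and only if there exists ρ ∈ fft(P) that survives abstraction from I with τ_I(ρ) = σ ∪ I. -/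
/-! ### Abstraction on partial failure traces -/

/-- A partial failure trace survives abstraction from `I ⊆ A`:
(i) every refusal set occurring in it contains `I`;
(ii) every contiguous subsequence `X c₀ … c_n Y` with all `cᵢ ∈ I` has `X = Y`;
(iii) every contiguous subsequence `X c₀ … c_n a` with all `cᵢ ∈ I` and `a ∉ I`
has `a ∈ X`. -/
def Survives (I : Set ℕ) (ρ : PFT) : Prop :=
  (∀ pre : PFT, ∀ X : Set ℕ, ∀ post : PFT, ρ = pre ++ Sum.inr X :: post → I ⊆ X) ∧
  (∀ pre : PFT, ∀ X : Set ℕ, ∀ cs : List ℕ, ∀ Y : Set ℕ, ∀ post : PFT,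
      ρ = pre ++ Sum.inr X :: (cs.map Sum.inl ++ Sum.inr Y :: post) →
      cs ≠ [] → (∀ c ∈ cs, c ∈ I) → X = Y) ∧
  (∀ pre : PFT, ∀ X : Set ℕ, ∀ cs : List ℕ, ∀ a : ℕ, ∀ post : PFT,
      ρ = pre ++ Sum.inr X :: (cs.map Sum.inl ++ Sum.inl a :: post) →
      cs ≠ [] → (∀ c ∈ cs, c ∈ I) → a ∉ I → a ∈ X)

/-- `AbsRel I ρ σ`: `σ = τ_I(ρ)`, i.e. `σ` is the result of contracting every
subsequence `X c₀ … c_n X` of `ρ` (with all `cᵢ ∈ I`) to `X` and omitting all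
remaining occurrences of actions `c ∈ I`. -/
inductive AbsRel (I : Set ℕ) : PFT → PFT → Prop
  | nil : AbsRel I [] []
  | actKeep {a ρ σ} : a ∉ I → AbsRel I ρ σ →
      AbsRel I (Sum.inl a :: ρ) (Sum.inl a :: σ)
  | actDrop {c ρ σ} : c ∈ I → AbsRel I ρ σ → AbsRel I (Sum.inl c :: ρ) σ
  | contract {X : Set ℕ} {cs : List ℕ} {ρ σ} : cs ≠ [] → (∀ c ∈ cs, c ∈ I) →
      AbsRel I (Sum.inr X :: ρ) σ →
      AbsRel I (Sum.inr X :: (cs.map Sum.inl ++ Sum.inr X :: ρ)) σ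
  | ref {X : Set ℕ} {ρ σ} :
      (¬ ∃ (cs : List ℕ) (ρ' : PFT), cs ≠ [] ∧ (∀ c ∈ cs, c ∈ I) ∧
          ρ = cs.map Sum.inl ++ Sum.inr X :: ρ') →
      AbsRel I ρ σ → AbsRel I (Sum.inr X :: ρ) (Sum.inr X :: σ)

/-- `σ ∪ I`: the trace `σ` with every refusal set `X` replaced by `X ∪ I`. -/
def addI (I : Set ℕ) (σ : PFT) : PFT :=
  σ.map fun e => match e with
    | Sum.inl a => Sum.inl a
    | Sum.inr X => Sum.inr (X ∪ I)

/-- The trace element `e` is a visible action belonging to `I`. -/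
def Hidden (I : Set ℕ) (e : Elt) : Prop := ∃ c ∈ I, e = Sum.inl c

theorem not_hidden_inr {I X : Set ℕ} : ¬ Hidden I (Sum.inr X) := by
  rintro ⟨c, _, h⟩
  cases h

theorem not_hidden_inl {I : Set ℕ} {a : ℕ} (ha : a ∉ I) : ¬ Hidden I (Sum.inl a) := by
  rintro ⟨c, hc, h⟩
  cases h
  exact ha hc

/-- The first element of a trace that is not hidden is unique. -/
theorem first_not_hidden_unique {I : Set ℕ} {cs cs' : List ℕ} {e e' : Elt} {p p' : PFT}
    (hcs : ∀ c ∈ cs, c ∈ I) (hcs' : ∀ c ∈ cs', c ∈ I) (he : ¬ Hidden I e) (he' : ¬ Hidden I e')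
    (h : cs.map Sum.inl ++ e :: p = cs'.map Sum.inl ++ e' :: p') : e = e' := by
  induction cs generalizing cs' with
  | nil =>
    cases cs' with
    | nil => exact (List.cons.inj h).1
    | cons c' cs' => exact absurd ⟨c', hcs' c' (by simp), (List.cons.inj h).1⟩ he
  | cons c cs ih =>
    cases cs' with
    | nil => exact absurd ⟨c, hcs c (by simp), (List.cons.inj h).1.symm⟩ he'
    | cons c' cs' =>
      exact ih (fun x hx => hcs x (by simp [hx])) (fun x hx => hcs' x (by simp [hx]))
        (List.cons.inj h).2

/-- Every trace consists of a sequence of hidden actions, followed by nothing or by an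
element that is not hidden. -/
theorem exists_hidden_prefix (I : Set ℕ) (ρ : PFT) :
    ∃ cs : List ℕ, (∀ c ∈ cs, c ∈ I) ∧
      (ρ = cs.map Sum.inl ∨ ∃ e post, ¬ Hidden I e ∧ ρ = cs.map Sum.inl ++ e :: post) := by
  induction ρ with
  | nil => exact ⟨[], by simp, Or.inl rfl⟩
  | cons e ρ ih =>
    by_cases he : Hidden I e
    · obtain ⟨c, hc, rfl⟩ := he
      obtain ⟨cs, hcs, h⟩ := ih
      refine ⟨c :: cs, by simpa [hc] using hcs, ?_⟩
      rcases h with rfl | ⟨e, post, he, rfl⟩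
      · exact Or.inl rfl
      · exact Or.inr ⟨e, post, he, rfl⟩
    · exact ⟨[], by simp, Or.inr ⟨e, ρ, he, rfl⟩⟩

theorem Survives.nil {I : Set ℕ} : Survives I [] := by
  refine ⟨?_, ?_, ?_⟩ <;> intros <;> simp_all

theorem Survives.tail {I : Set ℕ} {e : Elt} {ρ : PFT} (h : Survives I (e :: ρ)) :
    Survives I ρ := by
  refine ⟨fun pre X post hρ => h.1 (e :: pre) X post (by simp [hρ]),
    fun pre X cs Y post hρ => h.2.1 (e :: pre) X cs Y post (by simp [hρ]),
    fun pre X cs a post hρ => h.2.2 (e :: pre) X cs a post (by simp [hρ])⟩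

theorem Survives.cons_inl {I : Set ℕ} {a : ℕ} {ρ : PFT} (h : Survives I ρ) :
    Survives I (Sum.inl a :: ρ) := by
  refine ⟨fun pre X post hρ => ?_, fun pre X cs Y post hρ => ?_,
    fun pre X cs b post hρ => ?_⟩ <;> rcases pre with _ | ⟨e, pre⟩
  · cases (List.cons.inj hρ).1
  · exact h.1 pre X post (List.cons.inj hρ).2
  · cases (List.cons.inj hρ).1
  · exact h.2.1 pre X cs Y post (List.cons.inj hρ).2
  · cases (List.cons.inj hρ).1
  · exact h.2.2 pre X cs b post (List.cons.inj hρ).2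

theorem Survives.cons_inr {I X : Set ℕ} {ρ : PFT} (h : Survives I ρ) (hX : I ⊆ X)
    (href : ∀ (cs : List ℕ) (Y : Set ℕ) (post : PFT), cs ≠ [] → (∀ c ∈ cs, c ∈ I) →
      ρ = cs.map Sum.inl ++ Sum.inr Y :: post → X = Y)
    (hact : ∀ (cs : List ℕ) (a : ℕ) (post : PFT), cs ≠ [] → (∀ c ∈ cs, c ∈ I) → a ∉ I →
      ρ = cs.map Sum.inl ++ Sum.inl a :: post → a ∈ X) :
    Survives I (Sum.inr X :: ρ) := by
  refine ⟨fun pre Z post hρ => ?_, fun pre Z cs Y post hρ => ?_,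
    fun pre Z cs b post hρ => ?_⟩ <;> rcases pre with _ | ⟨e, pre⟩
  · cases (List.cons.inj hρ).1
    exact hX
  · exact h.1 pre Z post (List.cons.inj hρ).2
  · cases (List.cons.inj hρ).1
    exact fun hne hcs => href cs Y post hne hcs (List.cons.inj hρ).2
  · exact h.2.1 pre Z cs Y post (List.cons.inj hρ).2
  · cases (List.cons.inj hρ).1
    exact fun hne hcs hb => hact cs b post hne hcs hb (List.cons.inj hρ).2
  · exact h.2.2 pre Z cs b post (List.cons.inj hρ).2

theorem absRel_hidden_append {I : Set ℕ} {cs : List ℕ} (hcs : ∀ c ∈ cs, c ∈ I) {ρ σ : PFT} :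
    AbsRel I (cs.map Sum.inl ++ ρ) σ ↔ AbsRel I ρ σ := by
  induction cs with
  | nil => rfl
  | cons c cs ih =>
    have hc : c ∈ I := hcs c (by simp)
    rw [← ih fun x hx => hcs x (by simp [hx])]
    constructor
    · intro h
      cases h with
      | actKeep hn => exact absurd hc hn
      | actDrop _ h => exact h
    · exact fun h => AbsRel.actDrop hc h

theorem AbsRel.exists_of_cons {I : Set ℕ} {ρ σ : PFT} {e : Elt} (h : AbsRel I ρ (e :: σ)) :
    ¬ Hidden I e ∧ ∃ (cs : List ℕ) (post : PFT), (∀ c ∈ cs, c ∈ I) ∧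
      ρ = cs.map Sum.inl ++ e :: post := by
  generalize hτ : e :: σ = τ at h
  induction h with
  | nil => cases hτ
  | actKeep ha _ _ =>
    cases hτ
    exact ⟨not_hidden_inl ha, [], _, by simp, rfl⟩
  | @actDrop c _ _ hc _ ih =>
    obtain ⟨he, cs, post, hcs, rfl⟩ := ih hτ
    exact ⟨he, c :: cs, post, by simpa [hc] using hcs, rfl⟩
  | contract _ _ _ ih =>
    obtain ⟨he, cs, post, hcs, h⟩ := ih hτ
    have : _ = e := first_not_hidden_unique (cs := []) (by simp) hcs not_hidden_inr he h
    subst this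
    exact ⟨he, [], _, by simp, rfl⟩
  | ref _ _ _ =>
    cases hτ
    exact ⟨not_hidden_inr, [], _, by simp, rfl⟩

/-- An abstracted trace starting with a refusal set is abstracted to a trace starting
with the same refusal set. -/
theorem AbsRel.exists_eq_cons {I X : Set ℕ} {ρ σ : PFT} (h : AbsRel I (Sum.inr X :: ρ) σ) :
    ∃ σ', σ = Sum.inr X :: σ' := by
  generalize hτ : (Sum.inr X :: ρ : PFT) = τ at h
  induction h generalizing ρ with
  | nil => cases hτ
  | actKeep => cases hτ
  | actDrop => cases hτ
  | contract _ _ _ ih =>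
    cases hτ
    exact ih rfl
  | ref =>
    cases hτ
    exact ⟨_, rfl⟩

theorem addI_eq_inr_cons {I X : Set ℕ} {σ τ : PFT} (h : addI I σ = Sum.inr X :: τ) :
    ∃ Y σ', σ = Sum.inr Y :: σ' ∧ X = Y ∪ I ∧ τ = addI I σ' := by
  rcases σ with _ | ⟨a | Y, σ⟩ <;> simp only [addI, List.map_nil, List.map_cons] at h
  · cases h
  · cases h
  · cases h
    exact ⟨Y, σ, rfl, rfl, rfl⟩

theorem addI_eq_inl_cons {I : Set ℕ} {a : ℕ} {σ τ : PFT} (h : addI I σ = Sum.inl a :: τ) :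
    ∃ σ', σ = Sum.inl a :: σ' ∧ τ = addI I σ' := by
  rcases σ with _ | ⟨b | Y, σ⟩ <;> simp only [addI, List.map_nil, List.map_cons] at h
  · cases h
  · cases h
    exact ⟨σ, rfl, rfl⟩
  · cases h

/-- `P` is stable and refuses all visible actions from `X`. -/
def Refuses (P : Expr) (X : Set ℕ) : Prop := (∀ a ∈ X, a ∉ initials P) ∧ stable P

theorem refuses_abs_iff {I X : Set ℕ} {P : Expr} :
    Refuses (.abs I P) X ↔ Refuses P (X ∪ I) := by
  constructor
  · rintro ⟨hX, hs⟩
    refine ⟨?_, fun ⟨Q, hQ⟩ => hs ⟨_, .absFree hQ fun a h => by cases h⟩⟩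
    rintro a ha ⟨Q, hQ⟩
    by_cases haI : a ∈ I
    · exact hs ⟨_, .absHide hQ haI⟩
    · exact hX a (ha.resolve_right haI) ⟨_, .absFree hQ fun b h => by cases h; exact haI⟩
  · rintro ⟨hX, hs⟩
    constructor
    · rintro a ha ⟨Q, hQ⟩
      cases hQ with
      | absFree h _ => exact hX a (Or.inl ha) ⟨_, h⟩
    · rintro ⟨Q, hQ⟩
      cases hQ with
      | absFree h _ => exact hs ⟨_, h⟩
      | absHide h ha => exact hX _ (Or.inr ha) ⟨_, h⟩

theorem Refuses.not_fft {P : Expr} {X : Set ℕ} (h : Refuses P X) {c : ℕ} (hc : c ∈ X)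
    {ρ : PFT} : ¬ fft P (Sum.inl c :: ρ) := by
  intro hf
  cases hf with
  | act hs _ => exact h.1 c hc ⟨_, hs⟩
  | tau hs _ => exact h.2 ⟨_, hs⟩

theorem Refuses.not_fft_append {P : Expr} {X I : Set ℕ} (h : Refuses P X) (hIX : I ⊆ X)
    {cs : List ℕ} (hne : cs ≠ []) (hcs : ∀ c ∈ cs, c ∈ I) {ρ : PFT} :
    ¬ fft P (cs.map Sum.inl ++ ρ) := by
  obtain ⟨c, cs, rfl⟩ := List.exists_cons_of_ne_nil hne
  exact h.not_fft (hIX (hcs c (by simp)))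

theorem exists_fft_of_fft_abs {I : Set ℕ} {P : Expr} {σ : PFT} (h : fft (.abs I P) σ) :
    ∃ ρ, fft P ρ ∧ Survives I ρ ∧ AbsRel I ρ (addI I σ) := by
  generalize hR : Expr.abs I P = R at h
  induction h generalizing P with
  | top => exact ⟨[], .top, .nil, .nil⟩
  | act hs _ ih =>
    subst hR
    cases hs with
    | absFree hs hn =>
      obtain ⟨ρ, hf, hsv, hr⟩ := ih rfl
      exact ⟨_, .act hs hf, hsv.cons_inl, .actKeep (hn _ rfl) hr⟩
  | tau hs _ ih =>
    subst hR
    cases hs with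
    | absFree hs hn =>
      obtain ⟨ρ, hf, hsv, hr⟩ := ih rfl
      exact ⟨ρ, .tau hs hf, hsv, hr⟩
    | absHide hs hc =>
      obtain ⟨ρ, hf, hsv, hr⟩ := ih rfl
      exact ⟨_, .act hs hf, hsv.cons_inl, .actDrop hc hr⟩
  | refusal hX hst _ ih =>
    subst hR
    obtain ⟨ρ, hf, hsv, hr⟩ := ih rfl
    have hP := refuses_abs_iff.1 ⟨hX, hst⟩
    refine ⟨_, .refusal hP.1 hP.2 hf, hsv.cons_inr Set.subset_union_right ?_ ?_, .ref ?_ hr⟩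
    · rintro cs Y post hne hcs rfl
      exact absurd hf (hP.not_fft_append Set.subset_union_right hne hcs)
    · rintro cs a post hne hcs _ rfl
      exact absurd hf (hP.not_fft_append Set.subset_union_right hne hcs)
    · rintro ⟨cs, post, hne, hcs, rfl⟩
      exact hP.not_fft_append Set.subset_union_right hne hcs hf
  | @timeoutRef _ _ X _ hX hst ht _ ih =>
    subst hR
    have hP := refuses_abs_iff.1 ⟨hX, hst⟩
    cases ht with
    | absFree ht _ =>
      obtain ⟨ρ, hf, hsv, hr⟩ := ih rfl
      obtain ⟨-, cs, post, hcs, rfl⟩ := AbsRel.exists_of_cons hr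
      rcases cs with _ | ⟨c, cs⟩
      · exact ⟨_, .timeoutRef hP.1 hP.2 ht hf, hsv, hr⟩
      · refine ⟨_, .timeoutAct hP.1 hP.2 ht hf (Or.inr (hcs c (by simp))),
          hsv.cons_inr Set.subset_union_right ?_ ?_,
          .contract (cs := c :: cs) (by simp) hcs ((absRel_hidden_append hcs).1 hr)⟩
        · intro cs' Y post' _ hcs' h
          exact Sum.inr.inj
            (first_not_hidden_unique (cs := c :: cs) hcs hcs' not_hidden_inr not_hidden_inr h)
        · intro cs' a post' _ hcs' ha h
          cases first_not_hidden_unique (cs := c :: cs) hcs hcs' not_hidden_inr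
            (not_hidden_inl ha) h
  | @timeoutAct _ _ X a _ hX hst ht _ ha ih =>
    subst hR
    have hP := refuses_abs_iff.1 ⟨hX, hst⟩
    cases ht with
    | absFree ht _ =>
      obtain ⟨ρ, hf, hsv, hr⟩ := ih rfl
      obtain ⟨hn, cs, post, hcs, rfl⟩ := AbsRel.exists_of_cons hr
      have hfP : fft P (Sum.inr (X ∪ I) :: (cs.map Sum.inl ++ Sum.inl a :: post)) := by
        rcases cs with _ | ⟨c, cs⟩
        · exact .timeoutAct hP.1 hP.2 ht hf (Or.inl ha)
        · exact .timeoutAct hP.1 hP.2 ht hf (Or.inr (hcs c (by simp)))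
      refine ⟨_, hfP, hsv.cons_inr Set.subset_union_right ?_ ?_, .ref ?_ hr⟩
      · intro cs' Y post' _ hcs' h
        cases first_not_hidden_unique hcs hcs' hn not_hidden_inr h
      · intro cs' b post' _ hcs' hb h
        cases first_not_hidden_unique hcs hcs' hn (not_hidden_inl hb) h
        exact Or.inl ha
      · rintro ⟨cs', post', _, hcs', h⟩
        cases first_not_hidden_unique hcs hcs' hn not_hidden_inr h

theorem fft_abs_of_fft {I : Set ℕ} {P : Expr} {ρ σ : PFT} (hf : fft P ρ)
    (hsv : Survives I ρ) (hr : AbsRel I ρ (addI I σ)) : fft (.abs I P) σ := by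
  induction hf generalizing σ with
  | top =>
    rcases σ with _ | ⟨e, σ⟩
    · exact .top
    · cases hr
  | act hs _ ih =>
    generalize hτ : addI I σ = τ at hr
    cases hr with
    | actKeep ha hr =>
      obtain ⟨σ', rfl, rfl⟩ := addI_eq_inl_cons hτ
      exact .act (.absFree hs fun b h => by cases h; exact ha) (ih hsv.tail hr)
    | actDrop hc hr =>
      subst hτ
      exact .tau (.absHide hs hc) (ih hsv.tail hr)
  | tau hs _ ih => exact .tau (.absFree hs fun b h => by cases h) (ih hsv hr)
  | @refusal P X ρ hX hst hf ih =>
    have hIX : I ⊆ X := hsv.1 [] X _ rfl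
    have hP : Refuses P X := ⟨hX, hst⟩
    generalize hτ : addI I σ = τ at hr
    cases hr with
    | contract hne hcs hr => exact absurd hf (hP.not_fft_append hIX hne hcs)
    | ref _ hr =>
      obtain ⟨Y, σ', rfl, rfl, rfl⟩ := addI_eq_inr_cons hτ
      have hA := refuses_abs_iff.2 hP
      exact .refusal hA.1 hA.2 (ih hsv.tail hr)
  | timeoutRef hX hst ht _ ih =>
    obtain ⟨τ, hτ⟩ := hr.exists_eq_cons
    obtain ⟨Y, σ', rfl, rfl, -⟩ := addI_eq_inr_cons hτ
    have hA := refuses_abs_iff.2 ⟨hX, hst⟩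
    exact .timeoutRef hA.1 hA.2 (.absFree ht fun b h => by cases h) (ih hsv hr)
  | @timeoutAct P Q X a ρ hX hst ht _ ha ih =>
    obtain ⟨τ, hτ⟩ := hr.exists_eq_cons
    obtain ⟨Y, σ', rfl, rfl, rfl⟩ := addI_eq_inr_cons hτ
    have hA := refuses_abs_iff.2 ⟨hX, hst⟩
    have htA : Step (.abs I P) .timeout (.abs I Q) := .absFree ht fun b h => by cases h
    rw [hτ] at hr
    generalize hω : (Sum.inl a :: ρ : PFT) = ω at hr hsv ih
    cases hr with
    | contract hne hcs hr =>
      exact .timeoutRef hA.1 hA.2 htA (ih hsv.tail (by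
        rw [absRel_hidden_append hcs, hτ]
        exact hr))
    | ref hno hr =>
      have hQ := ih hsv.tail hr
      obtain ⟨cs, hcs, rfl | ⟨e, post, he, rfl⟩⟩ := exists_hidden_prefix I ω
      · rw [← List.append_nil (cs.map _), absRel_hidden_append hcs] at hr
        rcases σ' with _ | ⟨e, σ'⟩
        · exact .refusal hA.1 hA.2 .top
        · cases hr
      · rcases e with b | Z
        · have hb : b ∉ I := fun hb => he ⟨b, hb, rfl⟩
          rw [absRel_hidden_append hcs] at hr
          generalize hυ : addI I σ' = υ at hr
          cases hr with
          | actDrop hb' _ => exact absurd hb' hb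
          | actKeep _ hr =>
            obtain ⟨σ'', rfl, rfl⟩ := addI_eq_inl_cons hυ
            have hbX : b ∈ Y ∪ I := by
              rcases cs with _ | ⟨c, cs⟩
              · cases hω
                exact ha
              · exact hsv.2.2 [] _ (c :: cs) b post rfl (by simp) hcs hb
            exact .timeoutAct hA.1 hA.2 htA hQ (hbX.resolve_right hb)
        · have hne : cs ≠ [] := by
            rintro rfl
            cases hω
          have hZ := hsv.2.1 [] _ cs Z post rfl hne hcs
          subst hZ
          exact absurd ⟨cs, post, hne, hcs, rfl⟩ hno

/-- For every process `P`, every `I ⊆ A` and every partial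
failure trace `σ`:  `σ ∈ fft(τ_I(P))` iff there exists `ρ ∈ fft(P)` that survives
abstraction from `I` with `τ_I(ρ) = σ ∪ I`. -/
theorem fft_abs_explicit (I : Set ℕ) (P : Expr) (hP : IsProcess P) (σ : PFT) :
    fft (.abs I P) σ ↔ ∃ ρ, fft P ρ ∧ Survives I ρ ∧ AbsRel I ρ (addI I σ) := by
  exact ⟨exists_fft_of_fft_abs, fun ⟨_, hf, hsv, hr⟩ => fft_abs_of_fft hf hsv hr⟩
end

section
/- Partial failure trace equivalence ≡*_FT is a congruence for the abstraction operators τ_I: if P ≡*_FT Q then τ_I(P) ≡*_FT τ_I(Q), for every I ⊆ A. -/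
/-- `AbsTrace I σ ρ`: the trace `σ` of a process `P` gives rise to the trace `ρ` of `τ_I(P)`. -/
inductive AbsTrace (I : Set ℕ) : PFT → PFT → Prop
  | nil : AbsTrace I [] []
  | visible {a σ ρ} : a ∉ I → AbsTrace I σ ρ → AbsTrace I (Sum.inl a :: σ) (Sum.inl a :: ρ)
  | hidden {i σ ρ} : i ∈ I → AbsTrace I σ ρ → AbsTrace I (Sum.inl i :: σ) ρ
  | refusal {X σ ρ} : (∀ i ∈ I, ∀ σ', σ ≠ Sum.inl i :: σ') → AbsTrace I σ ρ →
      AbsTrace I (Sum.inr (X ∪ I) :: σ) (Sum.inr X :: ρ)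
  | hiddenRef {X i σ ρ} : i ∈ I → AbsTrace I σ (Sum.inr X :: ρ) →
      AbsTrace I (Sum.inr (X ∪ I) :: Sum.inl i :: σ) (Sum.inr X :: ρ)
  | hiddenAct {X i a σ ρ} : i ∈ I → a ∈ X → AbsTrace I σ (Sum.inl a :: ρ) →
      AbsTrace I (Sum.inr (X ∪ I) :: Sum.inl i :: σ) (Sum.inr X :: Sum.inl a :: ρ)

theorem Step.abs_tau {I : Set ℕ} {P Q : Expr} (h : Step P .tau Q) :
    Step (.abs I P) .tau (.abs I Q) :=
  .absFree h (fun _ h => nomatch h)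

theorem Step.abs_timeout {I : Set ℕ} {P Q : Expr} (h : Step P .timeout Q) :
    Step (.abs I P) .timeout (.abs I Q) :=
  .absFree h (fun _ h => nomatch h)

theorem Step.abs_act {I : Set ℕ} {P Q : Expr} {a : ℕ} (ha : a ∉ I) (h : Step P (.act a) Q) :
    Step (.abs I P) (.act a) (.abs I Q) :=
  .absFree h (fun _ h => by cases h; exact ha)

theorem abs_refuses_iff {I X : Set ℕ} {P : Expr} :
    ((∀ a ∈ X, a ∉ initials (.abs I P)) ∧ stable (.abs I P)) ↔
      (∀ a ∈ X ∪ I, a ∉ initials P) ∧ stable P := by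
  constructor
  · rintro ⟨hX, hs⟩
    refine ⟨fun a ha ⟨P', hP'⟩ => ?_, fun ⟨P', hP'⟩ => hs ⟨_, hP'.abs_tau⟩⟩
    by_cases haI : a ∈ I
    · exact hs ⟨_, .absHide hP' haI⟩
    · exact hX a (ha.resolve_right haI) ⟨_, hP'.abs_act haI⟩
  · rintro ⟨hX, hs⟩
    constructor
    · rintro a ha ⟨P', hP'⟩
      cases hP' with
      | absFree h _ => exact hX a (Or.inl ha) ⟨_, h⟩
    · rintro ⟨P', hP'⟩
      cases hP' with
      | absFree h _ => exact hs ⟨_, h⟩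
      | absHide h ha => exact hX _ (Or.inr ha) ⟨_, h⟩

theorem not_fft_act_of_stable {P : Expr} {a : ℕ} {σ : PFT} (ha : a ∉ initials P)
    (hs : stable P) : ¬ fft P (Sum.inl a :: σ) := by
  intro h
  cases h with
  | act h _ => exact ha ⟨_, h⟩
  | tau h _ => exact hs ⟨_, h⟩

theorem fft_abs_of_act {I : Set ℕ} {P : Expr} {a : ℕ} {σ ρ : PFT}
    (hstep : ∀ Q Q', Step Q (.act a) Q' → fft Q' σ → fft (.abs I Q) ρ)
    (h : fft P (Sum.inl a :: σ)) : fft (.abs I P) ρ := by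
  generalize hτ : Sum.inl a :: σ = τ at h
  induction h with
  | act h hf _ => cases hτ; exact hstep _ _ h hf
  | tau h _ ih => exact .tau h.abs_tau (ih hτ)
  | _ => cases hτ

/-- A refusal of `X ∪ I` by `P` yields a refusal of `X` by `τ_I(P)`, provided this is so at the
state in which the trace proceeds beyond that refusal. -/
theorem fft_abs_of_refusal {I X : Set ℕ} {P : Expr} {σ ρ : PFT}
    (href : ∀ Q, (∀ a ∈ X ∪ I, a ∉ initials Q) → stable Q → fft Q σ →
      fft (.abs I Q) (Sum.inr X :: ρ))
    (htime : ∀ Q Q' a σ', σ = Sum.inl a :: σ' → a ∈ X ∪ I →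
      (∀ a ∈ X, a ∉ initials (.abs I Q)) → stable (.abs I Q) → Step Q .timeout Q' →
      fft Q' σ → fft (.abs I Q) (Sum.inr X :: ρ))
    (h : fft P (Sum.inr (X ∪ I) :: σ)) : fft (.abs I P) (Sum.inr X :: ρ) := by
  generalize hτ : Sum.inr (X ∪ I) :: σ = τ at h
  induction h with
  | top => cases hτ
  | act => cases hτ
  | tau h _ ih => exact .tau h.abs_tau (ih hτ)
  | refusal hX hs h _ => cases hτ; exact href _ hX hs h
  | timeoutRef hX hs h _ ih =>
    cases hτ
    obtain ⟨hX', hs'⟩ := abs_refuses_iff.2 ⟨hX, hs⟩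
    exact .timeoutRef hX' hs' h.abs_timeout (ih rfl)
  | timeoutAct hX hs h hf ha _ =>
    cases hτ
    obtain ⟨hX', hs'⟩ := abs_refuses_iff.2 ⟨hX, hs⟩
    exact htime _ _ _ _ rfl ha hX' hs' h hf

theorem AbsTrace.fft_abs {I : Set ℕ} {σ ρ : PFT} (hd : AbsTrace I σ ρ) {P : Expr}
    (h : fft P σ) : fft (.abs I P) ρ := by
  induction hd generalizing P with
  | nil => exact .top
  | visible ha _ ih => exact fft_abs_of_act (fun _ _ h hf => .act (h.abs_act ha) (ih hf)) h
  | hidden hi _ ih => exact fft_abs_of_act (fun _ _ h hf => .tau (.absHide h hi) (ih hf)) h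
  | refusal hσ hd ih =>
    refine fft_abs_of_refusal (fun Q hX hs hf => ?_) ?_ h
    · obtain ⟨hX', hs'⟩ := abs_refuses_iff.2 ⟨hX, hs⟩
      exact .refusal hX' hs' (ih hf)
    · rintro Q Q' a σ' rfl ha hX hs h hf
      have haI : a ∉ _ := fun haI => hσ a haI _ rfl
      cases hd with
      | visible _ _ => exact .timeoutAct hX hs h.abs_timeout (ih hf) (ha.resolve_right haI)
      | hidden hi _ => exact absurd hi haI
  | hiddenRef hi _ ih =>
    refine fft_abs_of_refusal
      (fun Q hX hs hf => absurd hf (not_fft_act_of_stable (hX _ (Or.inr hi)) hs)) ?_ h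
    intro Q Q' _ _ _ _ hX hs h hf
    exact .timeoutRef hX hs h.abs_timeout
      (fft_abs_of_act (fun _ _ h hf => .tau (.absHide h hi) (ih hf)) hf)
  | hiddenAct hi ha _ ih =>
    refine fft_abs_of_refusal
      (fun Q hX hs hf => absurd hf (not_fft_act_of_stable (hX _ (Or.inr hi)) hs)) ?_ h
    intro Q Q' _ _ _ _ hX hs h hf
    exact .timeoutAct hX hs h.abs_timeout
      (fft_abs_of_act (fun _ _ h hf => .tau (.absHide h hi) (ih hf)) hf) ha

theorem exists_absTrace_of_fft_abs {I : Set ℕ} {P : Expr} {ρ : PFT} (h : fft (.abs I P) ρ) :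
    ∃ σ, AbsTrace I σ ρ ∧ fft P σ := by
  generalize hE : Expr.abs I P = E at h
  induction h generalizing P with
  | top => exact ⟨[], .nil, .top⟩
  | act h _ ih =>
    subst hE
    cases h with
    | absFree h ha =>
      obtain ⟨σ, hd, hf⟩ := ih rfl
      exact ⟨_, .visible (ha _ rfl) hd, .act h hf⟩
  | tau h _ ih =>
    subst hE
    cases h with
    | absFree h _ =>
      obtain ⟨σ, hd, hf⟩ := ih rfl
      exact ⟨_, hd, .tau h hf⟩
    | absHide h hi =>
      obtain ⟨σ, hd, hf⟩ := ih rfl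
      exact ⟨_, .hidden hi hd, .act h hf⟩
  | refusal hX hs _ ih =>
    subst hE
    obtain ⟨hX, hs⟩ := abs_refuses_iff.1 ⟨hX, hs⟩
    obtain ⟨σ, hd, hf⟩ := ih rfl
    refine ⟨_, .refusal ?_ hd, .refusal hX hs hf⟩
    rintro i hi σ' rfl
    exact not_fft_act_of_stable (hX i (Or.inr hi)) hs hf
  | timeoutRef hX hs h _ ih =>
    subst hE
    obtain ⟨hX, hs⟩ := abs_refuses_iff.1 ⟨hX, hs⟩
    cases h with
    | absFree h _ =>
      obtain ⟨σ, hd, hf⟩ := ih rfl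
      cases hd with
      | hidden hi hd => exact ⟨_, .hiddenRef hi hd, .timeoutAct hX hs h hf (Or.inr hi)⟩
      | refusal hσ hd => exact ⟨_, .refusal hσ hd, .timeoutRef hX hs h hf⟩
      | hiddenRef hi hd => exact ⟨_, .hiddenRef hi hd, .timeoutRef hX hs h hf⟩
      | hiddenAct hi ha hd => exact ⟨_, .hiddenAct hi ha hd, .timeoutRef hX hs h hf⟩
  | timeoutAct hX hs h _ ha ih =>
    subst hE
    obtain ⟨hX, hs⟩ := abs_refuses_iff.1 ⟨hX, hs⟩
    cases h with
    | absFree h _ =>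
      obtain ⟨σ, hd, hf⟩ := ih rfl
      cases hd with
      | visible haI hd =>
        refine ⟨_, .refusal ?_ (.visible haI hd), .timeoutAct hX hs h hf (Or.inl ha)⟩
        rintro i hi σ' ⟨⟩
        exact haI hi
      | hidden hi hd => exact ⟨_, .hiddenAct hi ha hd, .timeoutAct hX hs h hf (Or.inr hi)⟩

theorem fft_abs_iff {I : Set ℕ} {P : Expr} {ρ : PFT} :
    fft (.abs I P) ρ ↔ ∃ σ, AbsTrace I σ ρ ∧ fft P σ :=
  ⟨exists_absTrace_of_fft_abs, fun ⟨_, hd, hf⟩ => hd.fft_abs hf⟩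

/-- Partial failure trace equivalence is a congruence for the
abstraction operators `τ_I`. -/
theorem fft_congruence_abs (I : Set ℕ) (P Q : Expr)
    (hP : IsProcess P) (hQ : IsProcess Q) (h : fftSet P = fftSet Q) :
    fftSet (.abs I P) = fftSet (.abs I Q) := by
  ext ρ
  have hσ (σ : PFT) : fft P σ ↔ fft Q σ := Set.ext_iff.1 h σ
  change fft (.abs I P) ρ ↔ fft (.abs I Q) ρ
  simp only [fft_abs_iff, hσ]
end

section
/- For every process P, every relational renaming R ⊆ A×A (with all sets {b | (a,b) ∈ R} finite) and every partial failure trace σ: σ ∈ fft(R(P)) if and only if there exists ρ ∈ fft(P) with ρ ∈ R^{-1}(σ). -/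
/-! ### Renaming on partial failure traces -/

/-- `R⁻¹(X) = {a | ∃ b ∈ X. (a,b) ∈ R}`. -/
def invSet (R : Set (ℕ × ℕ)) (X : Set ℕ) : Set ℕ := {a | ∃ b ∈ X, (a, b) ∈ R}

/-- `RenInv R σ ρ`: `ρ ∈ R⁻¹(σ)`, i.e. `ρ` is obtained from `σ` by replacing each
refusal set `X` by `R⁻¹(X)` and each action `b` by some action `a` with
`(a,b) ∈ R`, where for an action occurrence `b` immediately preceded by a refusal
set `X` one requires `b ∈ X ↔ a ∈ R⁻¹(X)`. -/
inductive RenInv (R : Set (ℕ × ℕ)) : PFT → PFT → Prop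
  | nil : RenInv R [] []
  | act {a b σ ρ} : (a, b) ∈ R → RenInv R σ ρ →
      RenInv R (Sum.inl b :: σ) (Sum.inl a :: ρ)
  | refNil {X} : RenInv R [Sum.inr X] [Sum.inr (invSet R X)]
  | refRef {X Y σ ρ} : RenInv R (Sum.inr Y :: σ) ρ →
      RenInv R (Sum.inr X :: Sum.inr Y :: σ) (Sum.inr (invSet R X) :: ρ)
  | refAct {X a b σ ρ} : (a, b) ∈ R → (b ∈ X ↔ a ∈ invSet R X) → RenInv R σ ρ →
      RenInv R (Sum.inr X :: Sum.inl b :: σ) (Sum.inr (invSet R X) :: Sum.inl a :: ρ)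

theorem stable_ren {R : Set (ℕ × ℕ)} {P : Expr} : stable (.ren R P) ↔ stable P := by
  constructor
  · rintro h ⟨Q, hQ⟩
    exact h ⟨_, .renTau hQ⟩
  · rintro h ⟨Q, hQ⟩
    cases hQ with
    | renTau hQ => exact h ⟨_, hQ⟩

theorem mem_initials_ren {R : Set (ℕ × ℕ)} {P : Expr} {b : ℕ} :
    b ∈ initials (.ren R P) ↔ ∃ a ∈ initials P, (a, b) ∈ R := by
  constructor
  · rintro ⟨Q, hQ⟩
    cases hQ with
    | renAct hQ hab => exact ⟨_, ⟨_, hQ⟩, hab⟩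
  · rintro ⟨a, ⟨Q, hQ⟩, hab⟩
    exact ⟨_, .renAct hQ hab⟩

theorem refuses_ren {R : Set (ℕ × ℕ)} {P : Expr} {X : Set ℕ} :
    (∀ b ∈ X, b ∉ initials (.ren R P)) ↔ ∀ a ∈ invSet R X, a ∉ initials P := by
  simp only [mem_initials_ren, invSet, Set.mem_ofPred_eq]
  grind

theorem mem_initials_of_fft {P : Expr} {a : ℕ} {ρ : PFT} (hs : stable P)
    (h : fft P (Sum.inl a :: ρ)) : a ∈ initials P := by
  cases h with
  | act h _ => exact ⟨_, h⟩
  | tau h _ => exact absurd ⟨_, h⟩ hs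

theorem RenInv.tail_of_inr {R : Set (ℕ × ℕ)} {X : Set ℕ} {σ ρ : PFT}
    (h : RenInv R (Sum.inr X :: σ) ρ) :
    ∃ ρ', ρ = Sum.inr (invSet R X) :: ρ' ∧ RenInv R σ ρ' := by
  cases h with
  | refNil => exact ⟨_, rfl, .nil⟩
  | refRef h => exact ⟨_, rfl, h⟩
  | refAct hab _ h => exact ⟨_, rfl, .act hab h⟩

/-- A refusal set may be prepended to a renamed trace as soon as the next action, if any,
is not in the inverse image of that set. -/
theorem RenInv.cons_inr {R : Set (ℕ × ℕ)} {X : Set ℕ} {σ ρ : PFT} (h : RenInv R σ ρ)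
    (hX : ∀ a ρ', ρ = Sum.inl a :: ρ' → a ∉ invSet R X) :
    RenInv R (Sum.inr X :: σ) (Sum.inr (invSet R X) :: ρ) := by
  cases h with
  | nil => exact .refNil
  | act hab h =>
    have ha := hX _ _ rfl
    exact .refAct hab ⟨fun hb => ⟨_, hb, hab⟩, fun h' => absurd h' ha⟩ h
  | refNil => exact .refRef .refNil
  | refRef h => exact .refRef (.refRef h)
  | refAct hab hb h => exact .refRef (.refAct hab hb h)

theorem exists_fft_of_fft_ren {R : Set (ℕ × ℕ)} {P : Expr} {σ : PFT}
    (h : fft (.ren R P) σ) : ∃ ρ, fft P ρ ∧ RenInv R σ ρ := by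
  generalize hE : Expr.ren R P = E at h
  induction h generalizing P with
  | top => exact ⟨[], .top, .nil⟩
  | act hst _ ih =>
    subst hE
    cases hst with
    | renAct hst hab =>
      obtain ⟨ρ, hρ, hr⟩ := ih rfl
      exact ⟨_, .act hst hρ, .act hab hr⟩
  | tau hst _ ih =>
    subst hE
    cases hst with
    | renTau hst =>
      obtain ⟨ρ, hρ, hr⟩ := ih rfl
      exact ⟨_, .tau hst hρ, hr⟩
  | refusal hX hs _ ih =>
    subst hE
    rw [refuses_ren] at hX
    rw [stable_ren] at hs
    obtain ⟨ρ, hρ, hr⟩ := ih rfl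
    refine ⟨_, .refusal hX hs hρ, hr.cons_inr ?_⟩
    rintro a ρ' rfl ha
    exact hX a ha (mem_initials_of_fft hs hρ)
  | timeoutRef hX hs hst _ ih =>
    subst hE
    rw [refuses_ren] at hX
    rw [stable_ren] at hs
    cases hst with
    | renTimeout hst =>
      obtain ⟨ρ, hρ, hr⟩ := ih rfl
      obtain ⟨ρ', rfl, -⟩ := hr.tail_of_inr
      exact ⟨_, .timeoutRef hX hs hst hρ, hr⟩
  | timeoutAct hX hs hst _ hb ih =>
    subst hE
    rw [refuses_ren] at hX
    rw [stable_ren] at hs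
    cases hst with
    | renTimeout hst =>
      obtain ⟨ρ, hρ, hr⟩ := ih rfl
      cases hr with
      | act hab hr =>
        have ha := (⟨_, hb, hab⟩ : _ ∈ invSet R _)
        exact ⟨_, .timeoutAct hX hs hst hρ ha, .refAct hab (iff_of_true hb ha) hr⟩

theorem fft_ren_of_fft {R : Set (ℕ × ℕ)} {P : Expr} {σ ρ : PFT}
    (h : fft P ρ) (hr : RenInv R σ ρ) : fft (.ren R P) σ := by
  induction h generalizing σ with
  | top =>
    cases hr
    exact .top
  | act hst _ ih =>
    cases hr with
    | act hab hr => exact .act (.renAct hst hab) (ih hr)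
  | tau hst _ ih => exact .tau (.renTau hst) (ih hr)
  | refusal hX hs _ ih =>
    cases hr with
    | refNil => exact .refusal (refuses_ren.2 hX) (stable_ren.2 hs) .top
    | refRef hr => exact .refusal (refuses_ren.2 hX) (stable_ren.2 hs) (ih hr)
    | refAct hab _ hr =>
      exact .refusal (refuses_ren.2 hX) (stable_ren.2 hs) (ih (.act hab hr))
  | timeoutRef hX hs hst _ ih =>
    have key := ih hr
    cases hr with
    | refNil | refRef | refAct =>
      exact .timeoutRef (refuses_ren.2 hX) (stable_ren.2 hs) (.renTimeout hst) key
  | timeoutAct hX hs hst _ ha ih =>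
    cases hr with
    | refRef hr => cases hr
    | refAct hab hb hr =>
      exact .timeoutAct (refuses_ren.2 hX) (stable_ren.2 hs) (.renTimeout hst)
        (ih (.act hab hr)) (hb.2 ha)

/-- For every process `P`, every relational renaming `R ⊆ A×A`
with finite images and every partial failure trace `σ`:
`σ ∈ fft(R(P))` iff there exists `ρ ∈ fft(P)` with `ρ ∈ R⁻¹(σ)`. -/
theorem fft_ren_explicit (R : Set (ℕ × ℕ)) (hR : ∀ a : ℕ, {b | (a, b) ∈ R}.Finite)
    (P : Expr) (hP : IsProcess P) (σ : PFT) :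
    fft (.ren R P) σ ↔ ∃ ρ, fft P ρ ∧ RenInv R σ ρ := by
  constructor
  · exact exists_fft_of_fft_ren
  · rintro ⟨ρ, hρ, hr⟩
    exact fft_ren_of_fft hρ hr
end
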